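/- For every ε > 0 there exists C > 0 such that for every real N ≥ 1 and every v ∈ ℓ²(ℤ; ℂ): define, for n ∈ ℤ, Q(n) := ∑ over all (n₁, n₂, n₃, m₁, m₂, m₃) ∈ ℤ⁶ satisfying n = n₁ − n₂ + n₃ with n₂ ∉ {n₁, n₃}, n₁ = m₁ − m₂ + m₃ with m₂ ∉ {m₁, m₃}, |μ₁| > N, and |μ₁ + μ₂| > 125 · |μ₁|^{1 − 1/100}, of (1/(|μ₁| · |μ₁ + μ₂|)) · |v_{m₁}| |v_{m₂}| |v_{m₃}| |v_{n₂}| |v_{n₃}|, where μ₁ := 2(n − n₁)(n − n₃) and μ₂ := 2(n₁ − m₁)(n₁ − m₃). Then Q is finite for every n, belongs to ℓ²(ℤ), and ‖Q‖ ≤ C N^{−1 + 1/200 + ε} ‖v‖⁵. -/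

import Mathlib

open scoped BigOperators

/-- The ℓ²(ℤ;ℂ) norm `(∑ₙ |vₙ|²)^{1/2}`. -/
noncomputable def l2norm (v : ℤ → ℂ) : ℝ := Real.sqrt (∑' n : ℤ, ‖v n‖ ^ 2)

/-- Membership in ℓ²(ℤ;ℂ). -/
def Memℓ2 (v : ℤ → ℂ) : Prop := Summable fun n : ℤ => ‖v n‖ ^ 2

/-- First-generation phase `μ₁ = 2(n − n₁)(n − n₃)`, where `q.1 = (n₁, n₂, n₃)`. -/
def mu1 (n : ℤ) (q : (ℤ × ℤ × ℤ) × (ℤ × ℤ × ℤ)) : ℤ :=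
  2 * (n - q.1.1) * (n - q.1.2.2)

/-- Second-generation phase `μ₂ = 2(n₁ − m₁)(n₁ − m₃)`, where `q.2 = (m₁, m₂, m₃)`. -/
def mu2 (q : (ℤ × ℤ × ℤ) × (ℤ × ℤ × ℤ)) : ℤ :=
  2 * (q.1.1 - q.2.1) * (q.1.1 - q.2.2.2)

/-- Two-generation frequencies in the non-resonant region
`|μ₁ + μ₂| > 125 |μ₁|^{1 − 1/100}` with `|μ₁| > N`. -/
def cond10 (N : ℝ) (n : ℤ) (q : (ℤ × ℤ × ℤ) × (ℤ × ℤ × ℤ)) : Prop :=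
  n = q.1.1 - q.1.2.1 + q.1.2.2 ∧ q.1.2.1 ≠ q.1.1 ∧ q.1.2.1 ≠ q.1.2.2 ∧
  q.1.1 = q.2.1 - q.2.2.1 + q.2.2.2 ∧ q.2.2.1 ≠ q.2.1 ∧ q.2.2.1 ≠ q.2.2.2 ∧
  N < |((mu1 n q : ℤ) : ℝ)| ∧
  125 * |((mu1 n q : ℤ) : ℝ)| ^ ((1:ℝ) - 1/100) < |((mu1 n q + mu2 q : ℤ) : ℝ)|

/-- The summand `(1/(|μ₁| |μ₁ + μ₂|)) |v_{m₁}| |v_{m₂}| |v_{m₃}| |v_{n₂}| |v_{n₃}|`. -/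
noncomputable def term10 (v : ℤ → ℂ) (n : ℤ) (q : (ℤ × ℤ × ℤ) × (ℤ × ℤ × ℤ)) : ℝ :=
  1 / (|((mu1 n q : ℤ) : ℝ)| * |((mu1 n q + mu2 q : ℤ) : ℝ)|) *
    (‖v q.2.1‖ * ‖v q.2.2.1‖ * ‖v q.2.2.2‖ * ‖v q.1.2.1‖ * ‖v q.1.2.2‖)

/-- The majorant `Q(n)` of the quintic boundary term `N⁽³⁾₀`. -/
noncomputable def Q10 (N : ℝ) (v : ℤ → ℂ) (n : ℤ) : ℝ :=
  ∑' q : {q : (ℤ × ℤ × ℤ) × (ℤ × ℤ × ℤ) // cond10 N n q}, term10 v n q.1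

open scoped ENNReal

/-- The divisor bound `d(n) ≤ C n ^ δ`. -/
theorem exists_card_divisors_le_rpow {δ : ℝ} (hδ : 0 < δ) :
    ∃ C : ℝ, 0 < C ∧ ∀ n : ℕ, n ≠ 0 → (n.divisors.card : ℝ) ≤ C * (n : ℝ) ^ δ := by
  have hL : 0 < Real.log 2 := Real.log_pos (by norm_num)
  obtain ⟨P, hP⟩ := exists_nat_ge ((2 : ℝ) ^ (1 / δ))
  set M : ℝ := 1 + 1 / (δ * Real.log 2) with hM
  have hM1 : 1 ≤ M := by
    have : 0 < 1 / (δ * Real.log 2) := by positivity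
    linarith
  refine ⟨M ^ P, by positivity, fun n hn => ?_⟩
  have hprime : ∀ p ∈ n.primeFactors, ((n.factorization p + 1 : ℕ) : ℝ) ≤
      (if p < P then M else 1) * ((p : ℝ) ^ n.factorization p) ^ δ := by
    intro p hp
    have hp2 : (2 : ℝ) ≤ p := by exact_mod_cast (Nat.prime_of_mem_primeFactors hp).two_le
    set a := n.factorization p
    have hcomm : ((p : ℝ) ^ a) ^ δ = ((p : ℝ) ^ δ) ^ a := by
      rw [← Real.rpow_natCast, ← Real.rpow_natCast, ← Real.rpow_mul (by linarith),
        ← Real.rpow_mul (by linarith), mul_comm]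
    rw [hcomm]
    split_ifs with h
    · have h1 : 1 + δ * Real.log 2 ≤ (p : ℝ) ^ δ := by
        calc 1 + δ * Real.log 2 ≤ Real.exp (Real.log 2 * δ) := by
              have := Real.add_one_le_exp (Real.log 2 * δ)
              linarith
          _ = (2 : ℝ) ^ δ := by rw [Real.rpow_def_of_pos (by norm_num)]
          _ ≤ (p : ℝ) ^ δ := by gcongr
      have h2 : 1 + a * (δ * Real.log 2) ≤ (1 + δ * Real.log 2) ^ a :=
        one_add_mul_le_pow (by have : 0 < δ * Real.log 2 := by positivity
                               linarith) a
      have h3 : (1 + δ * Real.log 2) ^ a ≤ ((p : ℝ) ^ δ) ^ a := by gcongr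
      have h4 : M * (1 + a * (δ * Real.log 2)) =
          (1 + a) + 1 / (δ * Real.log 2) + a * (δ * Real.log 2) := by
        rw [hM]; field_simp; ring
      have h5 : M * (1 + a * (δ * Real.log 2)) ≤ M * ((p : ℝ) ^ δ) ^ a := by
        gcongr; exact h2.trans h3
      have h6 : 0 ≤ 1 / (δ * Real.log 2) + a * (δ * Real.log 2) := by positivity
      push_cast
      linarith
    · have h1 : (2 : ℝ) ≤ (p : ℝ) ^ δ := by
        calc (2 : ℝ) = ((2 : ℝ) ^ (1 / δ)) ^ δ := by
              rw [← Real.rpow_mul (by norm_num)]; simp [hδ.ne']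
          _ ≤ (p : ℝ) ^ δ := by
              gcongr
              exact hP.trans (by exact_mod_cast not_lt.mp h)
      calc ((a + 1 : ℕ) : ℝ) ≤ ((2 ^ a : ℕ) : ℝ) := by
            exact_mod_cast Nat.lt_two_pow_self
        _ = (2 : ℝ) ^ a := by push_cast; rfl
        _ ≤ 1 * ((p : ℝ) ^ δ) ^ a := by rw [one_mul]; gcongr
  have hprod : (n : ℝ) ^ δ = ∏ p ∈ n.primeFactors, ((p : ℝ) ^ n.factorization p) ^ δ := by
    rw [Real.finsetProd_rpow _ _ (fun p _ => by positivity)]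
    congr 1
    conv_lhs => rw [← Nat.prod_factorization_pow_eq_self hn]
    simp [Finsupp.prod]
  have hconst : ∏ p ∈ n.primeFactors, (if p < P then M else 1) ≤ M ^ P := by
    rw [Finset.prod_ite, Finset.prod_const, Finset.prod_const_one, mul_one]
    refine pow_le_pow_right₀ hM1 ?_
    calc (n.primeFactors.filter (· < P)).card ≤ (Finset.range P).card :=
          Finset.card_le_card fun p hp => by
            simpa using (Finset.mem_filter.mp hp).2
      _ = P := Finset.card_range P
  rw [Nat.card_divisors hn, hprod]
  push_cast
  calc ∏ p ∈ n.primeFactors, ((n.factorization p : ℝ) + 1)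
      ≤ ∏ p ∈ n.primeFactors, ((if p < P then M else 1) *
          ((p : ℝ) ^ n.factorization p) ^ δ) :=
        Finset.prod_le_prod (fun p _ => by positivity) fun p hp => by
          simpa using hprime p hp
    _ = (∏ p ∈ n.primeFactors, (if p < P then M else 1)) *
          ∏ p ∈ n.primeFactors, ((p : ℝ) ^ n.factorization p) ^ δ := Finset.prod_mul_distrib
    _ ≤ _ := by
        gcongr

/-- An integer `k ≠ 0` has at most `2 d(|k|)` ordered factorizations. -/
theorem encard_mul_fiber_le {k : ℤ} (hk : k ≠ 0) :
    ENat.card {p : ℤ × ℤ // p.1 * p.2 = k} ≤ 2 * k.natAbs.divisors.card := by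
  let f : {p : ℤ × ℤ // p.1 * p.2 = k} → Bool × k.natAbs.divisors := fun p =>
    (decide (0 ≤ p.1.1), ⟨p.1.1.natAbs, by
      rw [Nat.mem_divisors]
      exact ⟨Int.natAbs_dvd_natAbs.mpr ⟨p.1.2, p.2.symm⟩, by simpa using hk⟩⟩)
  have hf : Function.Injective f := by
    rintro ⟨⟨a, b⟩, hp⟩ ⟨⟨c, d⟩, hq⟩ h
    simp only [f, Prod.mk.injEq, decide_eq_decide, Subtype.mk.injEq] at h hp hq
    have hac : a = c := by omega
    subst hac
    have ha : a ≠ 0 := by rintro rfl; simp at hp; exact hk hp.symm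
    have hbd : b = d := mul_left_cancel₀ ha (hp.trans hq.symm)
    subst hbd
    rfl
  calc _ ≤ ENat.card (Bool × k.natAbs.divisors) := ENat.card_le_card_of_injective hf
    _ = _ := by
        rw [ENat.card_eq_coe_fintype_card, Fintype.card_prod, Fintype.card_bool, Fintype.card_coe]
        push_cast
        rfl

theorem exists_tsum_mul_le {δ : ℝ} (hδ : 0 < δ) :
    ∃ C : ℝ, 0 < C ∧ ∀ f : ℤ → ℝ≥0∞, f 0 = 0 →
      ∑' p : ℤ × ℤ, f (p.1 * p.2) ≤
        ENNReal.ofReal C * ∑' k : ℤ, ENNReal.ofReal (|(k : ℝ)| ^ δ) * f k := by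
  obtain ⟨C, hC, hdiv⟩ := exists_card_divisors_le_rpow hδ
  refine ⟨2 * C, by positivity, fun f hf => ?_⟩
  rw [← (Equiv.sigmaFiberEquiv fun p : ℤ × ℤ => p.1 * p.2).tsum_eq, ENNReal.tsum_sigma',
    ← ENNReal.tsum_mul_left]
  refine ENNReal.tsum_le_tsum fun k => ?_
  have hfib : ∀ p : {p : ℤ × ℤ // p.1 * p.2 = k},
      f (((Equiv.sigmaFiberEquiv fun p : ℤ × ℤ => p.1 * p.2) ⟨k, p⟩).1 *
        ((Equiv.sigmaFiberEquiv fun p : ℤ × ℤ => p.1 * p.2) ⟨k, p⟩).2) = f k := fun p =>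
    congrArg f p.2
  simp_rw [hfib]
  rw [ENNReal.tsum_const]
  rcases eq_or_ne k 0 with rfl | hk
  · simp [hf]
  rw [← mul_assoc]
  gcongr
  have h1 : ((ENat.card {p : ℤ × ℤ // p.1 * p.2 = k} : ℕ∞) : ℝ≥0∞) ≤
      ((2 * k.natAbs.divisors.card : ℕ) : ℝ≥0∞) := by
    exact_mod_cast ENat.toENNReal_le.mpr (encard_mul_fiber_le hk)
  refine h1.trans ?_
  rw [← ENNReal.ofReal_mul (by positivity), ← ENNReal.ofReal_natCast]
  refine ENNReal.ofReal_le_ofReal ?_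
  have h2 := hdiv k.natAbs (by simpa using hk)
  rw [Nat.cast_natAbs, Int.cast_abs] at h2
  push_cast
  linarith

theorem tsum_ofReal_abs_int_rpow_ne_top {b : ℝ} (hb : 1 < b) :
    ∑' k : ℤ, ENNReal.ofReal (|(k : ℝ)| ^ (-b)) ≠ ⊤ :=
  (Real.summable_abs_int_rpow hb).tsum_ofReal_ne_top

theorem abs_int_sub_rpow_le {δ : ℝ} (hδ : 0 ≤ δ) {c k : ℤ} (hc : c ≠ 0) (hk : k ≠ 0) :
    |((c - k : ℤ) : ℝ)| ^ δ ≤ 2 ^ δ * |(k : ℝ)| ^ δ * |(c : ℝ)| ^ δ := by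
  have hc1 : (1 : ℝ) ≤ |(c : ℝ)| := by exact_mod_cast Int.one_le_abs hc
  have hk1 : (1 : ℝ) ≤ |(k : ℝ)| := by exact_mod_cast Int.one_le_abs hk
  rw [← Real.mul_rpow (by norm_num) (by positivity), ← Real.mul_rpow (by positivity) (by positivity)]
  refine Real.rpow_le_rpow (by positivity) ?_ hδ
  push_cast
  have := abs_sub (c : ℝ) k
  nlinarith

/-- Summability over the differences `(n - n₁, n - n₃)` and `(n₁ - m₁, n₁ - m₃)`. -/
theorem summable_phase_weight {η : ℝ} (hη : 0 < η) :
    Summable fun p : (ℤ × ℤ) × (ℤ × ℤ) =>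
      if p.2.1 * p.2.2 = 0 then 0 else
        |((p.1.1 * p.1.2 : ℤ) : ℝ)| ^ (-(1 + η)) *
          |((p.1.1 * p.1.2 + p.2.1 * p.2.2 : ℤ) : ℝ)| ^ (-(1 + η)) := by
  set δ := η / 3 with hδdef
  have hδ : 0 < δ := by positivity
  obtain ⟨C, hC, hsum⟩ := exists_tsum_mul_le hδ
  let h : ℤ → ℝ≥0∞ := fun k => ENNReal.ofReal (|(k : ℝ)| ^ (-(1 + η)))
  have h0 : h 0 = 0 := by
    simp only [h, Int.cast_zero, abs_zero]
    rw [Real.zero_rpow (by linarith)]; simp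
  have hmul : ∀ (s : ℝ) (k : ℤ), k ≠ 0 → ENNReal.ofReal (|(k : ℝ)| ^ s) * h k =
      ENNReal.ofReal (|(k : ℝ)| ^ (-(1 + η) + s)) := fun s k hk => by
    rw [← ENNReal.ofReal_mul (by positivity), mul_comm, Real.rpow_add (by positivity)]
  set D := ENNReal.ofReal C * ENNReal.ofReal (2 ^ δ) *
    ∑' k : ℤ, ENNReal.ofReal (|(k : ℝ)| ^ (-(1 + η - δ))) with hD
  have hDtop : D ≠ ⊤ := ENNReal.mul_ne_top (by finiteness)
    (tsum_ofReal_abs_int_rpow_ne_top (by linarith))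
  have hinner : ∀ k : ℤ, k ≠ 0 →
      ∑' q : ℤ × ℤ, (if q.1 * q.2 = 0 then 0 else h (k + q.1 * q.2)) ≤
        D * ENNReal.ofReal (|(k : ℝ)| ^ δ) := fun k hk => by
    refine (hsum (fun j => if j = 0 then 0 else h (k + j)) (by simp)).trans ?_
    rw [hD, mul_assoc, mul_assoc, ← (Equiv.subRight k).tsum_eq]
    gcongr
    rw [mul_left_comm, ← ENNReal.ofReal_mul (by positivity), ← ENNReal.tsum_mul_right]
    refine ENNReal.tsum_le_tsum fun c => ?_
    simp only [Equiv.subRight_apply, add_sub_cancel]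
    rcases eq_or_ne c 0 with rfl | hc
    · simp [h0]
    calc _ ≤ ENNReal.ofReal (|((c - k : ℤ) : ℝ)| ^ δ) * h c := by
          gcongr; split_ifs <;> simp
      _ ≤ ENNReal.ofReal (2 ^ δ * |(k : ℝ)| ^ δ * |(c : ℝ)| ^ δ) * h c := by
          gcongr; exact abs_int_sub_rpow_le hδ.le hc hk
      _ = _ := by
          rw [ENNReal.ofReal_mul (by positivity), mul_assoc, hmul δ c hc]
          ring_nf
  have hfin : ∑' p : (ℤ × ℤ) × (ℤ × ℤ),
      (if p.2.1 * p.2.2 = 0 then 0 else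
        h (p.1.1 * p.1.2) * h (p.1.1 * p.1.2 + p.2.1 * p.2.2)) ≠ ⊤ := by
    rw [ENNReal.tsum_prod']
    have hle : ∀ p : ℤ × ℤ, ∑' q : ℤ × ℤ, (if q.1 * q.2 = 0 then 0 else
        h (p.1 * p.2) * h (p.1 * p.2 + q.1 * q.2)) ≤
        D * (fun k : ℤ => ENNReal.ofReal (|(k : ℝ)| ^ δ) * h k) (p.1 * p.2) := fun p => by
      rcases eq_or_ne (p.1 * p.2) 0 with hp | hp
      · simp [hp, h0]
      calc _ = h (p.1 * p.2) * ∑' q : ℤ × ℤ, (if q.1 * q.2 = 0 then 0 else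
              h (p.1 * p.2 + q.1 * q.2)) := by
            rw [← ENNReal.tsum_mul_left]
            refine tsum_congr fun q => ?_
            split_ifs <;> simp
        _ ≤ h (p.1 * p.2) * (D * ENNReal.ofReal (|((p.1 * p.2 : ℤ) : ℝ)| ^ δ)) := by
            gcongr; exact hinner _ hp
        _ = _ := by ring
    refine ((ENNReal.tsum_le_tsum hle).trans_lt ?_).ne
    rw [ENNReal.tsum_mul_left]
    refine ENNReal.mul_lt_top hDtop.lt_top
      ((hsum (fun k : ℤ => ENNReal.ofReal (|(k : ℝ)| ^ δ) * h k) (by simp [h0])).trans_lt ?_)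
    refine ENNReal.mul_lt_top (by finiteness) ?_
    refine (ENNReal.tsum_le_tsum fun k => ?_).trans_lt
      (tsum_ofReal_abs_int_rpow_ne_top (b := 1 + δ) (by linarith)).lt_top
    rcases eq_or_ne k 0 with rfl | hk
    · simp [h0]
    · have hk' : (0 : ℝ) < |(k : ℝ)| := by positivity
      rw [hmul δ k hk, ← ENNReal.ofReal_mul (by positivity), ← Real.rpow_add hk']
      refine le_of_eq ?_
      congr 2
      rw [hδdef]; ring
  refine (ENNReal.summable_toReal hfin).congr fun p => ?_
  split_ifs
  · simp
  · rw [ENNReal.toReal_mul, ENNReal.toReal_ofReal (by positivity),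
      ENNReal.toReal_ofReal (by positivity)]

theorem sq_one_div_mul_le_rpow {N A B η : ℝ} (hN : 1 ≤ N) (hη : η ≤ 1) (hA : N < A)
    (hB : A ^ ((1 : ℝ) - 1 / 100) < B) :
    (1 / (A * B)) ^ 2 ≤
      N ^ (-(199 / 100) * (1 - η)) * (A ^ (-(1 + η)) * B ^ (-(1 + η))) := by
  have hA0 : 0 < A := by linarith
  have hB0 : 0 < B := (Real.rpow_pos_of_pos hA0 _).trans hB
  have hsq : ∀ x : ℝ, 0 < x → (1 / x) ^ 2 = x ^ (-(1 + η)) * x ^ (-(1 - η)) := fun x hx => by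
    rw [← Real.rpow_add hx, show -(1 + η) + -(1 - η) = -(2 : ℕ) by push_cast; ring,
      Real.rpow_neg hx.le, Real.rpow_natCast, one_div, inv_pow]
  have h1 : B ^ (-(1 - η)) ≤ A ^ (-(99 / 100) * (1 - η)) := by
    calc B ^ (-(1 - η)) ≤ (A ^ ((1 : ℝ) - 1 / 100)) ^ (-(1 - η)) :=
          Real.rpow_le_rpow_of_nonpos (by positivity) hB.le (by linarith)
      _ = _ := by rw [← Real.rpow_mul hA0.le]; ring_nf
  have h2 : A ^ (-(1 - η)) * A ^ (-(99 / 100) * (1 - η)) ≤ N ^ (-(199 / 100) * (1 - η)) := by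
    rw [← Real.rpow_add hA0, show -(1 - η) + -(99 / 100) * (1 - η) = -(199 / 100) * (1 - η) by ring]
    exact Real.rpow_le_rpow_of_nonpos (by linarith) hA.le (by linarith)
  calc (1 / (A * B)) ^ 2 = (1 / A) ^ 2 * (1 / B) ^ 2 := by field_simp
    _ = A ^ (-(1 + η)) * B ^ (-(1 + η)) * (A ^ (-(1 - η)) * B ^ (-(1 - η))) := by
        rw [hsq A hA0, hsq B hB0]; ring
    _ ≤ A ^ (-(1 + η)) * B ^ (-(1 + η)) * (A ^ (-(1 - η)) * A ^ (-(99 / 100) * (1 - η))) := by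
        gcongr
    _ ≤ A ^ (-(1 + η)) * B ^ (-(1 + η)) * N ^ (-(199 / 100) * (1 - η)) := by gcongr
    _ = _ := by ring

theorem abs_two_mul_int_rpow_le {s : ℝ} (hs : 0 ≤ s) {k : ℤ} (hk : k ≠ 0) :
    |((2 * k : ℤ) : ℝ)| ^ (-s) ≤ |(k : ℝ)| ^ (-s) := by
  have hk' : (0 : ℝ) < |(k : ℝ)| := by positivity
  refine Real.rpow_le_rpow_of_nonpos hk' ?_ (by linarith)
  push_cast
  rw [abs_mul, abs_two]
  linarith

/-- The difference variables `((n - n₁, n - n₃), (n₁ - m₁, n₁ - m₃))`. -/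
def phaseDiff (n : ℤ) (q : (ℤ × ℤ × ℤ) × (ℤ × ℤ × ℤ)) : (ℤ × ℤ) × (ℤ × ℤ) :=
  ((n - q.1.1, n - q.1.2.2), (q.1.1 - q.2.1, q.1.1 - q.2.2.2))

theorem phaseDiff_injective (N : ℝ) (n : ℤ) :
    Function.Injective fun q : {q : (ℤ × ℤ × ℤ) × (ℤ × ℤ × ℤ) // cond10 N n q} =>
      phaseDiff n q.1 := by
  rintro ⟨⟨⟨a1, a2, a3⟩, b1, b2, b3⟩, hq⟩ ⟨⟨⟨c1, c2, c3⟩, d1, d2, d3⟩, hr⟩ h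
  have ha := hq.1
  have hb := hq.2.2.2.1
  have hc := hr.1
  have hd := hr.2.2.2.1
  simp only [phaseDiff, Prod.mk.injEq] at h ha hb hc hd
  simp only [Subtype.mk.injEq, Prod.mk.injEq]
  omega

theorem exists_sum_sq_weight_le {η : ℝ} (hη : 0 < η) (hη1 : η ≤ 1) :
    ∃ K : ℝ, 0 < K ∧ ∀ N : ℝ, 1 ≤ N → ∀ n : ℤ,
      (Summable fun q : {q : (ℤ × ℤ × ℤ) × (ℤ × ℤ × ℤ) // cond10 N n q} =>
        (1 / (|((mu1 n q.1 : ℤ) : ℝ)| * |((mu1 n q.1 + mu2 q.1 : ℤ) : ℝ)|)) ^ 2) ∧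
      ∑' q : {q : (ℤ × ℤ × ℤ) × (ℤ × ℤ × ℤ) // cond10 N n q},
        (1 / (|((mu1 n q.1 : ℤ) : ℝ)| * |((mu1 n q.1 + mu2 q.1 : ℤ) : ℝ)|)) ^ 2 ≤
          K * N ^ (-(199 / 100) * (1 - η)) := by
  have hF := summable_phase_weight hη
  set F : (ℤ × ℤ) × (ℤ × ℤ) → ℝ := fun p =>
      if p.2.1 * p.2.2 = 0 then 0 else
        |((p.1.1 * p.1.2 : ℤ) : ℝ)| ^ (-(1 + η)) *
          |((p.1.1 * p.1.2 + p.2.1 * p.2.2 : ℤ) : ℝ)| ^ (-(1 + η)) with hFdef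
  have hF0 : ∀ p, 0 ≤ F p := fun p => by
    simp only [hFdef]; split_ifs <;> positivity
  refine ⟨∑' p, F p + 1, by
    have : 0 ≤ ∑' p, F p := tsum_nonneg hF0
    positivity, fun N hN n => ?_⟩
  have hle : ∀ q : {q : (ℤ × ℤ × ℤ) × (ℤ × ℤ × ℤ) // cond10 N n q},
      (1 / (|((mu1 n q.1 : ℤ) : ℝ)| * |((mu1 n q.1 + mu2 q.1 : ℤ) : ℝ)|)) ^ 2 ≤
        N ^ (-(199 / 100) * (1 - η)) * F (phaseDiff n q.1) := by
    rintro ⟨q, -, -, -, h4, h5, h6, h7, h8⟩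
    have hm : (q.1.1 - q.2.1) * (q.1.1 - q.2.2.2) ≠ 0 :=
      mul_ne_zero (by omega) (by omega)
    have hA0 : (0 : ℝ) < |((mu1 n q : ℤ) : ℝ)| := by linarith
    have hpow := Real.rpow_pos_of_pos hA0 ((1 : ℝ) - 1 / 100)
    have hB0 : (0 : ℝ) < |((mu1 n q + mu2 q : ℤ) : ℝ)| := by linarith
    have e1 : mu1 n q = 2 * ((n - q.1.1) * (n - q.1.2.2)) := by rw [mu1]; ring
    have e2 : mu1 n q + mu2 q = 2 * ((n - q.1.1) * (n - q.1.2.2) +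
        (q.1.1 - q.2.1) * (q.1.1 - q.2.2.2)) := by rw [mu1, mu2]; ring
    have hX : (n - q.1.1) * (n - q.1.2.2) ≠ 0 := by
      intro h; rw [e1, h] at hA0; simp at hA0
    have hY : (n - q.1.1) * (n - q.1.2.2) + (q.1.1 - q.2.1) * (q.1.1 - q.2.2.2) ≠ 0 := by
      intro h; rw [e2, h] at hB0; simp at hB0
    refine (sq_one_div_mul_le_rpow hN hη1 h7 (by linarith)).trans ?_
    simp only [hFdef, phaseDiff, if_neg hm]
    rw [e2, e1]
    refine mul_le_mul_of_nonneg_left (mul_le_mul ?_ ?_ (by positivity) (by positivity))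
      (by positivity)
    · exact abs_two_mul_int_rpow_le (by linarith) hX
    · exact abs_two_mul_int_rpow_le (by linarith) hY
  have hinj := phaseDiff_injective N n
  have hs : Summable fun q : {q : (ℤ × ℤ × ℤ) × (ℤ × ℤ × ℤ) // cond10 N n q} =>
      N ^ (-(199 / 100) * (1 - η)) * F (phaseDiff n q.1) :=
    (hF.comp_injective hinj).mul_left _
  have hs' := Summable.of_nonneg_of_le (fun q => by positivity) hle hs
  refine ⟨hs', (hs'.tsum_le_tsum hle hs).trans ?_⟩
  rw [tsum_mul_left, mul_comm]
  gcongr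
  have := tsum_comp_le_tsum_of_inj hF hF0 hinj
  simp only [Function.comp_def] at this
  linarith

theorem summable_mul_and_tsum_mul_of_nonneg {α β : Type*} {f : α → ℝ} {g : β → ℝ}
    (hf : Summable f) (hg : Summable g) (hf0 : ∀ a, 0 ≤ f a) (hg0 : ∀ b, 0 ≤ g b) :
    (Summable fun p : α × β => f p.1 * g p.2) ∧
      ∑' p : α × β, f p.1 * g p.2 = (∑' a, f a) * ∑' b, g b :=
  have h := hf.mul_of_nonneg hg hf0 hg0
  ⟨h, (hf.tsum_mul_tsum hg h).symm⟩

/-- The sum over `n` of the squared products of `v` is controlled by `‖v‖¹⁰`. -/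
theorem summable_sigma_prod_sq {v : ℤ → ℂ} (hv : Memℓ2 v) (N : ℝ) :
    let G : (Σ n : ℤ, {q : (ℤ × ℤ × ℤ) × (ℤ × ℤ × ℤ) // cond10 N n q}) → ℝ := fun s =>
      (‖v s.2.1.2.1‖ * ‖v s.2.1.2.2.1‖ * ‖v s.2.1.2.2.2‖ * ‖v s.2.1.1.2.1‖ *
        ‖v s.2.1.1.2.2‖) ^ 2
    Summable G ∧ ∑' s, G s ≤ (∑' n : ℤ, ‖v n‖ ^ 2) ^ 5 := by
  intro G
  have h0 : ∀ n : ℤ, 0 ≤ ‖v n‖ ^ 2 := fun n => by positivity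
  obtain ⟨s2, t2⟩ := summable_mul_and_tsum_mul_of_nonneg hv hv h0 h0
  obtain ⟨s3, t3⟩ := summable_mul_and_tsum_mul_of_nonneg hv s2 h0 fun p => by positivity
  obtain ⟨s5, t5⟩ := summable_mul_and_tsum_mul_of_nonneg s3 s2 (fun p => by positivity)
    fun p => by positivity
  let φ : (Σ n : ℤ, {q : (ℤ × ℤ × ℤ) × (ℤ × ℤ × ℤ) // cond10 N n q}) →
      (ℤ × ℤ × ℤ) × (ℤ × ℤ) := fun s => (s.2.1.2, s.2.1.1.2)
  have hφ : Function.Injective φ := by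
    rintro ⟨n, ⟨⟨a1, a2, a3⟩, b1, b2, b3⟩, ha⟩ ⟨m, ⟨⟨c1, c2, c3⟩, d1, d2, d3⟩, hc⟩ h
    have ha1 := ha.1
    have hb1 := ha.2.2.2.1
    have hc1 := hc.1
    have hd1 := hc.2.2.2.1
    simp only [φ, Prod.mk.injEq] at h ha1 hb1 hc1 hd1
    obtain ⟨⟨rfl, rfl, rfl⟩, rfl, rfl⟩ := h
    obtain rfl : a1 = c1 := by omega
    obtain rfl : n = m := by omega
    rfl
  have hG : ∀ s, G s = (fun p : (ℤ × ℤ × ℤ) × (ℤ × ℤ) =>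
      ‖v p.1.1‖ ^ 2 * (‖v p.1.2.1‖ ^ 2 * ‖v p.1.2.2‖ ^ 2) *
        (‖v p.2.1‖ ^ 2 * ‖v p.2.2‖ ^ 2)) (φ s) := fun s => by
    simp only [G, φ]; ring
  refine ⟨(s5.comp_injective hφ).congr fun s => (hG s).symm, ?_⟩
  have hle := tsum_comp_le_tsum_of_inj s5 (fun p => by positivity) hφ
  rw [tsum_congr hG]
  refine hle.trans (le_of_eq ?_)
  rw [t5, t3, t2]
  ring

theorem summable_mul_and_tsum_mul_sq_le {ι : Type*} {f g : ι → ℝ} (hf : ∀ i, 0 ≤ f i)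
    (hg : ∀ i, 0 ≤ g i) (hf2 : Summable fun i => f i ^ 2) (hg2 : Summable fun i => g i ^ 2) :
    (Summable fun i => f i * g i) ∧
      (∑' i, f i * g i) ^ 2 ≤ (∑' i, f i ^ 2) * ∑' i, g i ^ 2 := by
  obtain ⟨h1, h2⟩ := Real.summable_and_inner_le_Lp_mul_Lq_tsum_of_nonneg
    Real.HolderConjugate.two_two hf hg (by simpa using hf2) (by simpa using hg2)
  refine ⟨h1, ?_⟩
  simp only [Real.rpow_two, ← Real.sqrt_eq_rpow] at h2
  have h3 : 0 ≤ ∑' i, f i * g i := tsum_nonneg fun i => mul_nonneg (hf i) (hg i)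
  calc _ ≤ (√(∑' i, f i ^ 2) * √(∑' i, g i ^ 2)) ^ 2 := by gcongr
    _ = _ := by
      rw [mul_pow, Real.sq_sqrt (tsum_nonneg fun i => by positivity),
        Real.sq_sqrt (tsum_nonneg fun i => by positivity)]

/-- **Bound on the quintic boundary term `N⁽³⁾₀` of the second normal form reduction.**
For every `ε > 0` there is `C > 0` such that for all `N ≥ 1` and `v ∈ ℓ²(ℤ;ℂ)`: `Q(n)` is
finite for each `n`, belongs to `ℓ²(ℤ)`, and `‖Q‖ ≤ C N^{−1+1/200+ε} ‖v‖⁵`. -/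
theorem N3_0_bound : ∀ ε > (0:ℝ), ∃ C > (0:ℝ), ∀ N : ℝ, 1 ≤ N → ∀ v : ℤ → ℂ, Memℓ2 v →
    (∀ n : ℤ, Summable fun q : {q : (ℤ × ℤ × ℤ) × (ℤ × ℤ × ℤ) // cond10 N n q} =>
      term10 v n q.1) ∧
    Summable (fun n : ℤ => Q10 N v n ^ 2) ∧
    Real.sqrt (∑' n : ℤ, Q10 N v n ^ 2)
      ≤ C * N ^ (-(1:ℝ) + 1/200 + ε) * l2norm v ^ 5 := by
  intro ε hε
  set η := min ε 1 with hη
  obtain ⟨K, hK, hW⟩ := exists_sum_sq_weight_le (η := η) (by positivity) (min_le_right _ _)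
  refine ⟨√K, by positivity, fun N hN v hv => ?_⟩
  set A := K * N ^ (-(199 / 100) * (1 - η)) with hA
  obtain ⟨hGs, hGt⟩ := summable_sigma_prod_sq hv N
  have hCS := fun n : ℤ => summable_mul_and_tsum_mul_sq_le
    (f := fun q : {q : (ℤ × ℤ × ℤ) × (ℤ × ℤ × ℤ) // cond10 N n q} =>
      1 / (|((mu1 n q.1 : ℤ) : ℝ)| * |((mu1 n q.1 + mu2 q.1 : ℤ) : ℝ)|))
    (g := fun q => ‖v q.1.2.1‖ * ‖v q.1.2.2.1‖ * ‖v q.1.2.2.2‖ * ‖v q.1.1.2.1‖ * ‖v q.1.1.2.2‖)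
    (fun q => by positivity) (fun q => by positivity) (hW N hN n).1 (hGs.sigma_factor n)
  have hQ : ∀ n : ℤ, Q10 N v n ^ 2 ≤
      A * ∑' q : {q : (ℤ × ℤ × ℤ) × (ℤ × ℤ × ℤ) // cond10 N n q},
        (‖v q.1.2.1‖ * ‖v q.1.2.2.1‖ * ‖v q.1.2.2.2‖ * ‖v q.1.1.2.1‖ * ‖v q.1.1.2.2‖) ^ 2 :=
    fun n => (hCS n).2.trans
      (mul_le_mul_of_nonneg_right (hW N hN n).2 (tsum_nonneg fun q => by positivity))
  have hB := hGs.sigma.mul_left A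
  have hQs := Summable.of_nonneg_of_le (fun n => sq_nonneg (Q10 N v n)) hQ hB
  refine ⟨fun n => (hCS n).1, hQs, ?_⟩
  have hA0 : 0 ≤ A := by positivity
  have htot : ∑' n : ℤ, Q10 N v n ^ 2 ≤ A * (∑' n : ℤ, ‖v n‖ ^ 2) ^ 5 := by
    refine (hQs.tsum_le_tsum hQ hB).trans ?_
    rw [tsum_mul_left]
    refine mul_le_mul_of_nonneg_left ?_ hA0
    exact hGs.tsum_sigma.symm.trans_le hGt
  have hNpow : √(N ^ (-(199 / 100) * (1 - η))) ≤ N ^ (-(1 : ℝ) + 1 / 200 + ε) := by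
    rw [Real.sqrt_eq_rpow, ← Real.rpow_mul (by linarith)]
    refine Real.rpow_le_rpow_of_exponent_le hN ?_
    have := min_le_left ε 1
    linarith
  have hS : √((∑' n : ℤ, ‖v n‖ ^ 2) ^ 5) = l2norm v ^ 5 := by
    have h0 : 0 ≤ ∑' n : ℤ, ‖v n‖ ^ 2 := tsum_nonneg fun n => by positivity
    rw [l2norm, Real.sqrt_eq_iff_mul_self_eq (by positivity) (by positivity), ← mul_pow,
      Real.mul_self_sqrt h0]
  calc √(∑' n : ℤ, Q10 N v n ^ 2) ≤ √(A * (∑' n : ℤ, ‖v n‖ ^ 2) ^ 5) := Real.sqrt_le_sqrt htot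
    _ = √K * √(N ^ (-(199 / 100) * (1 - η))) * l2norm v ^ 5 := by
        rw [Real.sqrt_mul hA0, hS, hA, Real.sqrt_mul hK.le]
    _ ≤ _ := by
        have : 0 ≤ l2norm v := Real.sqrt_nonneg _
        gcongr
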